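/- For every x0 ∈ 𝔇 there exists a unique map x : [0,∞) → 𝔇 such that x(0) = x0, x is differentiable with x'(t) = F(x(t)) for all t ≥ 0, and x(t) lies in the interior of 𝔇 for every t > 0. -/

import Mathlib

open Filter

def simplexD (d m : ℕ) : Set (Fin m → Fin d → ℝ) :=
  {x | ∀ i, (∀ v, 0 ≤ x i v) ∧ (∑ v, x i v) = 1}

noncomputable def piMap (d m : ℕ) (α : Fin d → Fin m → Fin m → ℝ)
    (x : Fin m → Fin d → ℝ) : Fin m → Fin d → ℝ :=
  fun i v => Real.exp (∑ j, α v i j * x j v) / ∑ u, Real.exp (∑ j, α u i j * x j u)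

noncomputable def FF (d m : ℕ) (α : Fin d → Fin m → Fin m → ℝ)
    (x : Fin m → Fin d → ℝ) : Fin m → Fin d → ℝ :=
  fun i v => -(x i v) + piMap d m α x i v

open Set in
/-- A globally Lipschitz `C¹` vector field on a Banach space is complete. -/
theorem exists_forall_hasDerivAt_of_lipschitzWith {E : Type*} [NormedAddCommGroup E]
    [NormedSpace ℝ E] [CompleteSpace E] {f : E → E} {K : NNReal} (hK : LipschitzWith K f)
    (hf : ContDiff ℝ 1 f) (x₀ : E) :
    ∃ γ : ℝ → E, γ 0 = x₀ ∧ ∀ t, HasDerivAt γ (f (γ t)) t := by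
  let v : (x : E) → TangentSpace (modelWithCornersSelf ℝ E) x := f
  have hv : ContMDiff (modelWithCornersSelf ℝ E) (modelWithCornersSelf ℝ E).tangent 1
      (fun x ↦ (⟨x, v x⟩ : TangentBundle (modelWithCornersSelf ℝ E) E)) :=
    contMDiff_vectorSpace_iff_contDiff.2 hf
  have hε : 0 < 1 / (1 + (K : ℝ)) := by positivity
  obtain ⟨γ, hγ0, hγ⟩ := exists_isMIntegralCurve_of_isMIntegralCurveOn hv hε
    (fun x ↦ by
      have hpl : IsPicardLindelof (fun _ ↦ f) (tmin := -(1 / (1 + (K : ℝ))))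
          (tmax := 1 / (1 + (K : ℝ))) ⟨0, by constructor <;> linarith⟩ x (‖f x‖₊ + 1) 0
          (‖f x‖₊ + K * (‖f x‖₊ + 1)) K := by
        refine .of_time_independent (fun z hz ↦ ?_) hK.lipschitzOnWith ?_
        · have h1 : ‖f z - f x‖ ≤ K * (‖f x‖ + 1) := by
            rw [← dist_eq_norm]
            refine (hK.dist_le_mul z x).trans ?_
            gcongr
            simpa using hz
          have h2 := norm_le_norm_add_norm_sub (f x) (f z)
          rw [norm_sub_rev] at h2
          push_cast
          linarith
        · have hK0 := K.coe_nonneg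
          simp only [sub_zero, zero_sub, neg_neg, max_self]
          push_cast
          rw [mul_one_div, div_le_iff₀ (by positivity)]
          nlinarith [norm_nonneg (f x)]
      obtain ⟨γ, hγ0, hγ⟩ := hpl.exists_eq_forall_mem_Icc_hasDerivWithinAt₀
      refine ⟨γ, hγ0, fun t ht ↦ ?_⟩
      have hderiv : HasFDerivWithinAt γ (ContinuousLinearMap.smulRight (1 : ℝ →L[ℝ] ℝ) (f (γ t)))
          (Ioo _ _) t :=
        ((hγ t (Ioo_subset_Icc_self ht)).mono Ioo_subset_Icc_self).hasFDerivWithinAt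
      exact hasMFDerivWithinAt_iff_hasFDerivWithinAt.2 hderiv) x₀
  refine ⟨γ, hγ0, fun t ↦ ?_⟩
  have hderiv : HasFDerivAt γ (ContinuousLinearMap.smulRight (1 : ℝ →L[ℝ] ℝ) (f (γ t))) t :=
    hasMFDerivAt_iff_hasFDerivAt.1 (hγ t)
  simpa using hderiv.hasDerivAt

theorem exp_div_sum_exp_sub_le {ι : Type*} [Fintype ι] {a b : ι → ℝ} {δ : ℝ}
    (h : ∀ u, |a u - b u| ≤ δ) (v : ι) :
    Real.exp (a v) / ∑ u, Real.exp (a u) - Real.exp (b v) / ∑ u, Real.exp (b u) ≤ 2 * δ := by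
  have hA : Real.exp (a v) ≤ ∑ u, Real.exp (a u) :=
    Finset.single_le_sum (f := fun u ↦ Real.exp (a u)) (fun _ _ ↦ (Real.exp_pos _).le)
      (Finset.mem_univ v)
  have hA0 : 0 < ∑ u, Real.exp (a u) := (Real.exp_pos _).trans_le hA
  have hB0 : 0 < ∑ u, Real.exp (b u) := Finset.sum_pos (fun _ _ ↦ Real.exp_pos _) ⟨v, by simp⟩
  have hsum : ∑ u, Real.exp (b u) ≤ Real.exp δ * ∑ u, Real.exp (a u) := by
    rw [Finset.mul_sum]
    refine Finset.sum_le_sum fun u _ ↦ ?_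
    rw [← Real.exp_add]
    exact Real.exp_le_exp.2 (by linarith [neg_le_of_abs_le (h u)])
  have hv : Real.exp (-δ) * Real.exp (a v) ≤ Real.exp (b v) := by
    rw [← Real.exp_add]
    exact Real.exp_le_exp.2 (by linarith [le_of_abs_le (h v)])
  have hle : Real.exp (-(2 * δ)) * (Real.exp (a v) / ∑ u, Real.exp (a u)) ≤
      Real.exp (b v) / ∑ u, Real.exp (b u) := by
    calc Real.exp (-(2 * δ)) * (Real.exp (a v) / ∑ u, Real.exp (a u))
        = (Real.exp (-δ) * Real.exp (a v)) / (Real.exp δ * ∑ u, Real.exp (a u)) := by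
          rw [show -(2 * δ) = -δ - δ by ring, Real.exp_sub]
          field_simp
      _ ≤ _ := by gcongr
  have h1 : Real.exp (a v) / ∑ u, Real.exp (a u) ≤ 1 := (div_le_one hA0).2 hA
  have h0 : 0 ≤ Real.exp (a v) / ∑ u, Real.exp (a u) := by positivity
  have hδ : 0 ≤ δ := (abs_nonneg _).trans (h v)
  nlinarith [Real.add_one_le_exp (-(2 * δ))]

section

variable {d m : ℕ} (α : Fin d → Fin m → Fin m → ℝ)

theorem piMap_pos (x : Fin m → Fin d → ℝ) (i : Fin m) (v : Fin d) : 0 < piMap d m α x i v :=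
  div_pos (Real.exp_pos _) (Finset.sum_pos (fun _ _ ↦ Real.exp_pos _) ⟨v, Finset.mem_univ v⟩)

theorem sum_piMap (hd : 0 < d) (x : Fin m → Fin d → ℝ) (i : Fin m) :
    ∑ v, piMap d m α x i v = 1 := by
  simp only [piMap]
  rw [← Finset.sum_div]
  exact div_self
    (Finset.sum_pos (fun _ _ ↦ Real.exp_pos _) ⟨⟨0, hd⟩, Finset.mem_univ _⟩).ne'

theorem contDiff_FF : ContDiff ℝ 1 (FF d m α) := by
  refine contDiff_pi.2 fun i ↦ contDiff_pi.2 fun v ↦ ?_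
  have hx : ∀ j u, ContDiff ℝ 1 fun x : Fin m → Fin d → ℝ ↦ x j u :=
    fun j u ↦ contDiff_apply_apply ℝ ℝ j u
  have hexp : ∀ u, ContDiff ℝ 1 fun x : Fin m → Fin d → ℝ ↦ Real.exp (∑ j, α u i j * x j u) :=
    fun u ↦ (ContDiff.sum fun j _ ↦ contDiff_const.mul (hx j u)).exp
  exact (hx i v).neg.add ((hexp v).div (ContDiff.sum fun u _ ↦ hexp u) fun x ↦
    (Finset.sum_pos (fun _ _ ↦ Real.exp_pos _) ⟨v, Finset.mem_univ v⟩).ne')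

theorem exists_lipschitzWith_FF : ∃ K, LipschitzWith K (FF d m α) := by
  set C : ℝ := ∑ v, ∑ i, ∑ j, |α v i j|
  have hC0 : 0 ≤ C := by positivity
  have hrow : ∀ v i, ∑ j, |α v i j| ≤ C := fun v i ↦
    (Finset.single_le_sum (f := fun i ↦ ∑ j, |α v i j|) (fun _ _ ↦ by positivity)
      (Finset.mem_univ i)).trans
    (Finset.single_le_sum (f := fun v ↦ ∑ i, ∑ j, |α v i j|) (fun _ _ ↦ by positivity)
      (Finset.mem_univ v))
  have hcoord : ∀ (x y : Fin m → Fin d → ℝ) i v, |x i v - y i v| ≤ dist x y := fun x y i v ↦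
    (dist_le_pi_dist (x i) (y i) v).trans (dist_le_pi_dist x y i)
  have hlin : ∀ (x y : Fin m → Fin d → ℝ) i u,
      |∑ j, α u i j * x j u - ∑ j, α u i j * y j u| ≤ C * dist x y := by
    intro x y i u
    rw [← Finset.sum_sub_distrib]
    calc |∑ j, (α u i j * x j u - α u i j * y j u)|
        ≤ ∑ j, |α u i j| * dist x y := by
          refine (Finset.abs_sum_le_sum_abs _ _).trans (Finset.sum_le_sum fun j _ ↦ ?_)
          rw [← mul_sub, abs_mul]
          gcongr
          exact hcoord x y j u
      _ ≤ C * dist x y := by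
          rw [← Finset.sum_mul]
          gcongr
          exact hrow u i
  have hpi : ∀ (x y : Fin m → Fin d → ℝ) i v,
      piMap d m α x i v - piMap d m α y i v ≤ 2 * (C * dist x y) :=
    fun x y i v ↦ exp_div_sum_exp_sub_le (hlin x y i) v
  refine ⟨⟨1 + 2 * C, by positivity⟩, LipschitzWith.of_dist_le_mul fun x y ↦ ?_⟩
  have hr : 0 ≤ (1 + 2 * C) * dist x y := by positivity
  refine (dist_pi_le_iff hr).2 fun i ↦ (dist_pi_le_iff hr).2 fun v ↦ ?_
  have h1 := hpi x y i v
  have h2 := hpi y x i v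
  rw [dist_comm] at h2
  have h3 := abs_le.1 (hcoord x y i v)
  rw [Real.dist_eq, abs_le]
  simp only [FF]
  constructor <;> linarith

end

theorem hasDerivAt_exp_mul {g : ℝ → ℝ} {p t : ℝ} (hg : HasDerivAt g (-(g t) + p) t) :
    HasDerivAt (fun s ↦ Real.exp s * g s) (Real.exp t * p) t := by
  exact ((Real.hasDerivAt_exp t).mul hg).congr_deriv (by ring)

theorem pos_of_hasDerivAt_neg_add_pos {g p : ℝ → ℝ} (hg : ∀ t, HasDerivAt g (-(g t) + p t) t)
    (hp : ∀ t, 0 < p t) (h0 : 0 ≤ g 0) {t : ℝ} (ht : 0 < t) : 0 < g t := by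
  have hmono : StrictMono fun s ↦ Real.exp s * g s :=
    strictMono_of_hasDerivAt_pos (fun s ↦ hasDerivAt_exp_mul (hg s))
      fun s ↦ mul_pos (Real.exp_pos s) (hp s)
  have h := hmono ht
  simp only [Real.exp_zero, one_mul] at h
  exact pos_of_mul_pos_right (h0.trans_lt h) (Real.exp_pos t).le

theorem eq_one_of_hasDerivAt_neg_add_one {g : ℝ → ℝ} (hg : ∀ t, HasDerivAt g (-(g t) + 1) t)
    (h0 : g 0 = 1) (t : ℝ) : g t = 1 := by
  have hd : ∀ s, HasDerivAt (fun s ↦ Real.exp s * (g s - 1)) 0 s := fun s ↦ by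
    have h := hasDerivAt_exp_mul (g := fun s ↦ g s - 1) (p := 0)
      (((hg s).sub_const 1).congr_deriv (by ring))
    simpa using h
  have h := is_const_of_deriv_eq_zero (fun s ↦ (hd s).differentiableAt) (fun s ↦ (hd s).deriv) t 0
  simp only [h0, sub_self, mul_zero, mul_eq_zero, Real.exp_ne_zero, false_or] at h
  linarith


/-- Existence and uniqueness of the semi-flow of `F` on `𝔇`: for every `x0 ∈ 𝔇` there is a
map `x : [0,∞) → 𝔇` with `x(0) = x0`, `x'(t) = F(x(t))` for all `t ≥ 0`, and `x(t)` in the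
interior of `𝔇` for all `t > 0`; the map is unique on `[0, ∞)`. -/
theorem exists_unique_semiflow (d m : ℕ) (hd : 2 ≤ d) (hm : 2 ≤ m)
    (α : Fin d → Fin m → Fin m → ℝ) (hsym : ∀ v i j, α v i j = α v j i)
    (x0 : Fin m → Fin d → ℝ) (hx0mem : x0 ∈ simplexD d m) :
    ∃ x : ℝ → Fin m → Fin d → ℝ,
      (x 0 = x0 ∧ (∀ t, 0 ≤ t → x t ∈ simplexD d m) ∧
        (∀ t, 0 ≤ t → HasDerivAt x (FF d m α (x t)) t) ∧
        (∀ t, 0 < t → ∀ i v, 0 < x t i v)) ∧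
      ∀ y : ℝ → Fin m → Fin d → ℝ,
        (y 0 = x0 ∧ (∀ t, 0 ≤ t → y t ∈ simplexD d m) ∧
          (∀ t, 0 ≤ t → HasDerivAt y (FF d m α (y t)) t) ∧
          (∀ t, 0 < t → ∀ i v, 0 < y t i v)) →
        ∀ t, 0 ≤ t → y t = x t := by
  obtain ⟨K, hK⟩ := exists_lipschitzWith_FF α
  obtain ⟨x, hx0, hx⟩ := exists_forall_hasDerivAt_of_lipschitzWith hK (contDiff_FF α) x0
  have hcoord : ∀ i v t, HasDerivAt (fun s ↦ x s i v) (-(x t i v) + piMap d m α (x t) i v) t :=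
    fun i v t ↦ hasDerivAt_pi.1 (hasDerivAt_pi.1 (hx t) i) v
  have hpos : ∀ t, 0 < t → ∀ i v, 0 < x t i v := fun t ht i v ↦
    pos_of_hasDerivAt_neg_add_pos (hcoord i v) (fun s ↦ piMap_pos α (x s) i v)
      (by rw [hx0]; exact (hx0mem i).1 v) ht
  have hsum : ∀ i t, ∑ v, x t i v = 1 := fun i ↦
    eq_one_of_hasDerivAt_neg_add_one (g := fun t ↦ ∑ v, x t i v)
      (fun t ↦ (HasDerivAt.fun_sum fun v _ ↦ hcoord i v t).congr_deriv (by
        rw [Finset.sum_add_distrib, Finset.sum_neg_distrib, sum_piMap α (by omega)]))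
      (by simp only [hx0]; exact (hx0mem i).2)
  refine ⟨x, ⟨hx0, fun t ht i ↦ ⟨fun v ↦ ?_, hsum i t⟩, fun t _ ↦ hx t, hpos⟩, ?_⟩
  · rcases ht.eq_or_lt with rfl | ht
    · rw [hx0]; exact (hx0mem i).1 v
    · exact (hpos t ht i v).le
  · rintro y ⟨hy0, -, hy, -⟩ t ht
    exact ODE_solution_unique (v := fun _ ↦ FF d m α) (fun _ ↦ hK)
      (fun s hs ↦ (hy s hs.1).continuousAt.continuousWithinAt)
      (fun s hs ↦ (hy s hs.1).hasDerivWithinAt)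
      (fun s _ ↦ (hx s).continuousAt.continuousWithinAt)
      (fun s _ ↦ (hx s).hasDerivWithinAt) (hy0.trans hx0.symm) ⟨ht, le_rfl⟩
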